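/- Let K be a field, m ≥ n ≥ 1, a_1,...,a_n ∈ K[x] nonzero with a_n | ... | a_1, M = ⟨a_i(x)·ε'_i⟩ ⊆ K[x]^n, M ∈ K[x]^{m×n}, and s ∈ Z^m a shift. Let δ_M = (δ_1,...,δ_m) be the s-pivot degrees of the relation module A_{M,M}. Then the row rank profile RRP_M equals the family F_{δ_M} = {x^i ε_j : 0 ≤ i < δ_j, 1 ≤ j ≤ m}. -/

import Mathlib

open Polynomial

noncomputable section

/-- s-row degree of a row vector of polynomials, with `deg 0 = ⊥`. -/
def rdeg {K : Type*} [Field K] {ν : ℕ} (s : Fin ν → ℤ) (p : Fin ν → Polynomial K) : WithBot ℤ :=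
  Finset.univ.sup fun i => WithBot.map (fun d : ℕ => (d : ℤ) + s i) (p i).degree

/-- `p` has s-pivot index `i` and s-pivot degree `d`. -/
def IsPivot {K : Type*} [Field K] {ν : ℕ} (s : Fin ν → ℤ) (p : Fin ν → Polynomial K)
    (i : Fin ν) (d : ℕ) : Prop :=
  (p i).degree = (d : WithBot ℕ) ∧
  WithBot.map (fun k : ℕ => (k : ℤ) + s i) (p i).degree = rdeg s p ∧
  ∀ j : Fin ν, WithBot.map (fun k : ℕ => (k : ℤ) + s j) (p j).degree = rdeg s p → j ≤ i

/-- P (given by its rows) is a basis of the K[x]-module N. -/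
def IsBasisOf {K : Type*} [Field K] {ρ ν : ℕ} (P : Fin ρ → Fin ν → Polynomial K)
    (N : Submodule (Polynomial K) (Fin ν → Polynomial K)) : Prop :=
  LinearIndependent (Polynomial K) P ∧ Submodule.span (Polynomial K) (Set.range P) = N

/-- the submodule M = ⟨a_i ε'_i⟩ of K[x]^n -/
def Mmod {K : Type*} [Field K] {n : ℕ} (a : Fin n → Polynomial K) :
    Submodule (Polynomial K) (Fin n → Polynomial K) :=
  Submodule.span (Polynomial K) (Set.range fun i => Pi.single i (a i))

/-- row-vector times matrix: (p M)_j = Σ_i p_i M_{i,j} -/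
def pmul {K : Type*} [Field K] {m n : ℕ} (M : Matrix (Fin m) (Fin n) (Polynomial K))
    (p : Fin m → Polynomial K) : Fin n → Polynomial K :=
  fun j => ∑ i, p i * M i j

/-- the monomial x^k ε_j of K[x]^{1×m}, encoded by the pair (k, j) -/
def monov {K : Type*} [Field K] {m : ℕ} (μ : ℕ × Fin m) : Fin m → Polynomial K :=
  Pi.single μ.2 (X ^ μ.1)

/-- the s-TOP order on monomials: x^a ε_i ≺ x^b ε_j iff (a+s_i, i) <_lex (b+s_j, j) -/
def sTopLT {m : ℕ} (s : Fin m → ℤ) (μ ν : ℕ × Fin m) : Prop :=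
  ((μ.1 : ℤ) + s μ.2 < (ν.1 : ℤ) + s ν.2) ∨
  ((μ.1 : ℤ) + s μ.2 = (ν.1 : ℤ) + s ν.2 ∧ μ.2 < ν.2)

/-- Lexicographic comparison of equal-cardinality families of monomials via their
≺-sorted lists: `F <lex G` iff the ≺-smallest element of the symmetric difference of
`F` and `G` belongs to `F`. -/
def famLT {m : ℕ} (s : Fin m → ℤ) (F G : Finset (ℕ × Fin m)) : Prop :=
  ∃ μ, μ ∈ F ∧ μ ∉ G ∧ ∀ ν, sTopLT s ν μ → (ν ∈ F ↔ ν ∈ G)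

/-- the family F_d = {x^i ε_j : 0 ≤ i < d_j, 1 ≤ j ≤ m} -/
def Fd {m : ℕ} (d : Fin m → ℕ) : Finset (ℕ × Fin m) :=
  Finset.univ.biUnion fun j => (Finset.range (d j)).image fun i => (i, j)

/-- The s-TOP order is the pullback of the order on `ℕ` along an injective map. -/
theorem exists_sTop_key {m : ℕ} (s : Fin m → ℤ) :
    ∃ e : ℕ × Fin m → ℕ, Function.Injective e ∧ ∀ μ ν, sTopLT s μ ν ↔ e μ < e ν := by
  obtain ⟨c, hc⟩ : ∃ c : ℤ, ∀ j, 0 ≤ s j + c := by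
    refine ⟨∑ j, |s j|, fun j => ?_⟩
    have h := Finset.single_le_sum (f := fun j => |s j|) (fun i _ => abs_nonneg _)
      (Finset.mem_univ j)
    have h' := neg_abs_le (s j)
    linarith
  have key : ∀ (a b : ℕ) (i j : Fin m),
      a * m + (i : ℕ) < b * m + (j : ℕ) ↔ a < b ∨ (a = b ∧ i < j) := by
    intro a b i j
    have hi := i.2
    have hj := j.2
    rcases lt_trichotomy a b with h | h | h
    · have : (a + 1) * m ≤ b * m := Nat.mul_le_mul_right m h
      rw [add_mul, one_mul] at this
      simp only [h, true_or, iff_true]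
      omega
    · subst h
      simp
    · have : (b + 1) * m ≤ a * m := Nat.mul_le_mul_right m h
      rw [add_mul, one_mul] at this
      constructor
      · intro; omega
      · rintro (h' | ⟨h', -⟩) <;> omega
  have hlt : ∀ μ ν : ℕ × Fin m, sTopLT s μ ν ↔
      (μ.1 + (s μ.2 + c)).toNat * m + (μ.2 : ℕ) < (ν.1 + (s ν.2 + c)).toNat * m + (ν.2 : ℕ) := by
    intro μ ν
    have h1 := hc μ.2
    have h2 := hc ν.2
    rw [key, sTopLT]
    refine or_congr (by omega) (and_congr_left fun _ => by omega)
  refine ⟨fun μ => (μ.1 + (s μ.2 + c)).toNat * m + (μ.2 : ℕ), fun μ ν h => ?_, hlt⟩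
  have h1 : ¬ sTopLT s μ ν := fun h' => absurd ((hlt _ _).1 h') (by simp only at h; omega)
  have h2 : ¬ sTopLT s ν μ := fun h' => absurd ((hlt _ _).1 h') (by simp only at h; omega)
  simp only [sTopLT, not_or, not_and, not_lt] at h1 h2
  have h3 : (μ.1 : ℤ) + s μ.2 = ν.1 + s ν.2 := le_antisymm h2.1 h1.1
  have h4 : μ.2 = ν.2 := le_antisymm (h2.2 h3.symm) (h1.2 h3)
  rw [h4] at h3
  exact Prod.ext (by omega) h4

theorem sTopLT_add {m : ℕ} {s : Fin m → ℤ} {μ ν : ℕ × Fin m} {a b : ℕ} (hab : a ≤ b)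
    (h : μ = ν ∨ sTopLT s μ ν) :
    (a + μ.1, μ.2) = (b + ν.1, ν.2) ∨ sTopLT s (a + μ.1, μ.2) (b + ν.1, ν.2) := by
  rcases h with rfl | h
  · rcases hab.eq_or_lt with rfl | hab
    · exact Or.inl rfl
    · right; left
      simp only
      omega
  · right
    simp only [sTopLT] at h ⊢
    rcases h with h | h
    · left; omega
    · rcases hab.eq_or_lt with rfl | hab
      · right
        exact ⟨by omega, h.2⟩
      · left; omega

theorem mem_Fd {m : ℕ} {d : Fin m → ℕ} {μ : ℕ × Fin m} : μ ∈ Fd d ↔ μ.1 < d μ.2 := by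
  obtain ⟨i, j⟩ := μ
  simp [Fd]

section Coefficients

variable {K : Type*} [Field K] {m : ℕ}

theorem coeff_monov (μ ν : ℕ × Fin m) :
    ((monov μ : Fin m → K[X]) ν.2).coeff ν.1 = if ν = μ then 1 else 0 := by
  obtain ⟨i, j⟩ := μ
  obtain ⟨k, l⟩ := ν
  by_cases h : l = j
  · subst h
    simp [monov, coeff_X_pow]
  · simp [monov, h]

theorem mem_span_monov {S : Set (ℕ × Fin m)} {p : Fin m → K[X]}
    (h : ∀ μ : ℕ × Fin m, (p μ.2).coeff μ.1 ≠ 0 → μ ∈ S) :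
    p ∈ Submodule.span K ((fun μ => (monov μ : Fin m → K[X])) '' S) := by
  rw [← Finset.univ_sum_single p]
  refine Submodule.sum_mem _ fun j _ => ?_
  have : (Pi.single j (p j) : Fin m → K[X]) =
      ∑ i ∈ (p j).support, (p j).coeff i • monov (i, j) := by
    conv_lhs => rw [(p j).as_sum_support]
    rw [← LinearMap.coe_single (R := K), map_sum]
    refine Finset.sum_congr rfl fun i _ => ?_
    rw [LinearMap.coe_single, monov, ← Pi.single_smul, smul_X_eq_monomial]
  rw [this]
  exact Submodule.sum_mem _ fun i hi => Submodule.smul_mem _ _ <|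
    Submodule.subset_span ⟨(i, j), h (i, j) (mem_support_iff.1 hi), rfl⟩

/-- All monomials of `p` are `≼` the monomial given by its s-pivot. -/
theorem IsPivot.eq_or_sTopLT {s : Fin m → ℤ} {p : Fin m → K[X]} {k : Fin m} {d : ℕ}
    (hp : IsPivot s p k d) {μ : ℕ × Fin m} (hμ : (p μ.2).coeff μ.1 ≠ 0) :
    μ = (d, k) ∨ sTopLT s μ (d, k) := by
  obtain ⟨i, j⟩ := μ
  obtain ⟨h1, h2, h3⟩ := hp
  simp only at hμ
  have hj : (p j).degree = ((p j).natDegree : WithBot ℕ) :=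
    degree_eq_natDegree fun h => hμ (by simp [h])
  have hi : i ≤ (p j).natDegree := le_natDegree_of_ne_zero hμ
  have hle : WithBot.map (fun k : ℕ => (k : ℤ) + s j) (p j).degree ≤ rdeg s p :=
    Finset.le_sup (f := fun i => WithBot.map (fun d : ℕ => (d : ℤ) + s i) (p i).degree)
      (Finset.mem_univ j)
  have h3 := h3 j
  rw [← h2, h1, hj] at hle h3
  replace hle : ((p j).natDegree : ℤ) + s j ≤ d + s k := WithBot.coe_le_coe.1 hle
  replace h3 : ((p j).natDegree : ℤ) + s j = d + s k → j ≤ k :=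
    fun h => h3 (congrArg ((↑) : ℤ → WithBot ℤ) h)
  rcases hle.eq_or_lt with heq | hlt
  · have hjk := h3 heq
    rcases hi.eq_or_lt with rfl | hi
    · rcases hjk.eq_or_lt with rfl | hjk
      · left
        simp only [Prod.mk.injEq, and_true]
        omega
      · exact Or.inr (Or.inr ⟨heq, hjk⟩)
    · right; left
      simp only
      omega
  · right; left
    simp only
    omega

/-- All monomials of `q • p` are `≼` the product of the leading monomial of `q` and the pivot
monomial of `p`. -/
theorem IsPivot.mul_eq_or_sTopLT {s : Fin m → ℤ} {p : Fin m → K[X]} {k : Fin m} {d : ℕ}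
    (hp : IsPivot s p k d) (q : K[X]) {μ : ℕ × Fin m} (hμ : (q * p μ.2).coeff μ.1 ≠ 0) :
    μ = (q.natDegree + d, k) ∨ sTopLT s μ (q.natDegree + d, k) := by
  obtain ⟨i, j⟩ := μ
  simp only [coeff_mul] at hμ
  obtain ⟨⟨a, b⟩, hab, hne⟩ := Finset.exists_ne_zero_of_sum_ne_zero hμ
  rw [Finset.HasAntidiagonal.mem_antidiagonal] at hab
  simp only at hab hne
  subst hab
  exact sTopLT_add (le_natDegree_of_ne_zero (left_ne_zero_of_mul hne))
    (hp.eq_or_sTopLT (μ := (b, j)) (right_ne_zero_of_mul hne))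

theorem IsPivot.coeff_mul_ne_zero {s : Fin m → ℤ} {p : Fin m → K[X]} {k : Fin m} {d : ℕ}
    (hp : IsPivot s p k d) {q : K[X]} (hq : q ≠ 0) : (q * p k).coeff (q.natDegree + d) ≠ 0 := by
  rw [← natDegree_eq_of_degree_eq_some hp.1, coeff_mul_degree_add_degree]
  refine mul_ne_zero (leadingCoeff_ne_zero.2 hq) (leadingCoeff_ne_zero.2 fun h => ?_)
  have := hp.1
  simp [h] at this

/-- A vector in the span of rows in ordered weak Popov form all of whose monomials lie below the
pivot monomials is zero. -/
theorem eq_zero_of_mem_span_of_isPivot {s : Fin m → ℤ} {P : Fin m → Fin m → K[X]}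
    {δ : Fin m → ℕ} (hpiv : ∀ k, IsPivot s (P k) k (δ k)) {p : Fin m → K[X]}
    (hp : p ∈ Submodule.span K[X] (Set.range P))
    (hδ : ∀ μ : ℕ × Fin m, (p μ.2).coeff μ.1 ≠ 0 → μ ∈ Fd δ) : p = 0 := by
  classical
  obtain ⟨e, he, hlt⟩ := exists_sTop_key s
  obtain ⟨q, rfl⟩ := (Submodule.mem_span_range_iff_exists_fun _).1 hp
  by_contra hne
  obtain ⟨k₀, -, hk₀⟩ := Finset.exists_ne_zero_of_sum_ne_zero hne
  obtain ⟨k, hk, hmax⟩ := (Finset.univ.filter fun k => q k ≠ 0).exists_max_image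
    (fun k => e ((q k).natDegree + δ k, k)) ⟨k₀, by simpa using left_ne_zero_of_smul hk₀⟩
  simp only [Finset.mem_filter, Finset.mem_univ, true_and] at hk hmax
  have hcoeff : ((∑ l, q l • P l) k).coeff ((q k).natDegree + δ k) =
      (q k * P k k).coeff ((q k).natDegree + δ k) := by
    rw [Finset.sum_apply, finsetSum_coeff]
    refine Finset.sum_eq_single k (fun l _ hlk => ?_) (by simp)
    by_contra hl
    have hql : q l ≠ 0 := fun h => hl (by simp [h])
    rcases (hpiv l).mul_eq_or_sTopLT (q l) (μ := ((q k).natDegree + δ k, k)) hl with h | h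
    · exact hlk (congrArg Prod.snd h).symm
    · exact absurd (hmax l hql) (not_le.2 ((hlt _ _).1 h))
  have := mem_Fd.1 (hδ ((q k).natDegree + δ k, k) (by
    simp only [hcoeff]
    exact (hpiv k).coeff_mul_ne_zero hk))
  simp only at this
  omega

/-- The normal form step: modulo the rows, a monomial outside `Fd δ` is a combination of smaller
monomials. -/
theorem map_monov_mem_span {W : Type*} [AddCommGroup W] [Module K W] {s : Fin m → ℤ}
    {P : Fin m → Fin m → K[X]} {δ : Fin m → ℕ} (hpiv : ∀ k, IsPivot s (P k) k (δ k))
    (φ : (Fin m → K[X]) →ₗ[K] W)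
    (hφ : ∀ p ∈ Submodule.span K[X] (Set.range P), φ p = 0) {μ : ℕ × Fin m} (hμ : μ ∉ Fd δ) :
    φ (monov μ) ∈ Submodule.span K ((fun ν => φ (monov ν)) '' {ν | sTopLT s ν μ}) := by
  obtain ⟨i, k⟩ := μ
  rw [mem_Fd, not_lt] at hμ
  simp only at hμ
  set q : K[X] := X ^ (i - δ k) with hq
  have hdeg : q.natDegree + δ k = i := by rw [hq, natDegree_X_pow]; omega
  set c : K := (q * P k k).coeff i with hc
  have hc0 : c ≠ 0 := by
    have := (hpiv k).coeff_mul_ne_zero (q := q) (pow_ne_zero _ X_ne_zero)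
    rwa [hdeg] at this
  have hmem : q • P k - c • monov (i, k) ∈
      Submodule.span K ((fun ν => (monov ν : Fin m → K[X])) '' {ν | sTopLT s ν (i, k)}) := by
    refine mem_span_monov fun ν hν => ?_
    rw [Pi.sub_apply, Pi.smul_apply, Pi.smul_apply, coeff_sub, coeff_smul, coeff_monov,
      smul_eq_mul] at hν
    by_cases h : ν = (i, k)
    · subst h
      simp [← hc] at hν
    · rw [if_neg h, smul_zero, sub_zero] at hν
      have := (hpiv k).mul_eq_or_sTopLT q hν
      rw [hdeg] at this
      exact this.resolve_left h
  have himg := Submodule.mem_map_of_mem (f := φ) hmem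
  rw [Submodule.map_span, Set.image_image, map_sub, map_smul φ c,
    hφ _ (Submodule.smul_mem _ _ (Submodule.subset_span ⟨k, rfl⟩)), zero_sub,
    Submodule.neg_mem_iff] at himg
  exact (Submodule.smul_mem_iff _ hc0).1 himg

theorem linearIndependent_map_monov {W : Type*} [AddCommGroup W] [Module K W] {s : Fin m → ℤ}
    {P : Fin m → Fin m → K[X]} {δ : Fin m → ℕ} (hpiv : ∀ k, IsPivot s (P k) k (δ k))
    (φ : (Fin m → K[X]) →ₗ[K] W)
    (hφ : ∀ p, φ p = 0 → p ∈ Submodule.span K[X] (Set.range P)) :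
    LinearIndependent K (fun μ : Fd δ => φ (monov μ.1)) := by
  rw [Fintype.linearIndependent_iff]
  intro g hg μ
  have hcoeff (ν : ℕ × Fin m) :
      ((∑ μ : Fd δ, g μ • (monov μ.1 : Fin m → K[X])) ν.2).coeff ν.1 =
        ∑ μ : Fd δ, if ν = μ.1 then g μ else 0 := by
    rw [Finset.sum_apply, finsetSum_coeff]
    refine Finset.sum_congr rfl fun μ _ => ?_
    rw [Pi.smul_apply, coeff_smul, coeff_monov, smul_eq_mul, mul_ite, mul_one, mul_zero]
  have hzero : ∑ μ : Fd δ, g μ • (monov μ.1 : Fin m → K[X]) = 0 := by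
    refine eq_zero_of_mem_span_of_isPivot hpiv (hφ _ (by simpa using hg)) fun ν hν => ?_
    rw [hcoeff] at hν
    obtain ⟨μ, -, hμ⟩ := Finset.exists_ne_zero_of_sum_ne_zero hν
    have : ν = μ.1 := by
      by_contra h
      exact hμ (if_neg h)
    exact this ▸ μ.2
  have := hcoeff μ.1
  rw [hzero] at this
  simpa [Subtype.coe_inj] using this.symm

end Coefficients

section Greedy

variable {K ι W : Type*} [Field K] [AddCommGroup W] [Module K W] {v : ι → W} {e : ι → ℕ}
  {F₀ : Finset ι}

theorem mem_span_of_reducible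
    (hred : ∀ μ ∉ F₀, v μ ∈ Submodule.span K (v '' {ν | e ν < e μ})) (μ : ι) :
    v μ ∈ Submodule.span K (v '' {ν | ν ∈ F₀ ∧ e ν ≤ e μ}) := by
  induction hn : e μ using Nat.strong_induction_on generalizing μ with
  | _ n ih =>
    subst hn
    by_cases hμ : μ ∈ F₀
    · exact Submodule.subset_span ⟨μ, ⟨hμ, le_rfl⟩, rfl⟩
    · refine (Submodule.span_le.2 ?_) (hred μ hμ)
      rintro _ ⟨ν, hν, rfl⟩
      have hsub : {ρ | ρ ∈ F₀ ∧ e ρ ≤ e ν} ⊆ {ρ | ρ ∈ F₀ ∧ e ρ ≤ e μ} :=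
        fun ρ hρ => ⟨hρ.1, hρ.2.trans (le_of_lt hν)⟩
      exact Submodule.span_mono (Set.image_mono hsub) (ih _ hν ν rfl)

theorem card_eq_finrank_of_reducible (hli : LinearIndependent K (fun μ : F₀ => v μ))
    (hred : ∀ μ ∉ F₀, v μ ∈ Submodule.span K (v '' {ν | e ν < e μ})) :
    F₀.card = Module.finrank K (Submodule.span K (Set.range v)) := by
  have : Submodule.span K (Set.range v) = Submodule.span K (Set.range fun μ : F₀ => v μ) := by
    refine le_antisymm (Submodule.span_le.2 ?_) (Submodule.span_mono ?_)
    · rintro _ ⟨μ, rfl⟩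
      refine Submodule.span_mono ?_ (mem_span_of_reducible hred μ)
      rintro _ ⟨ν, hν, rfl⟩
      exact Set.mem_range.2 ⟨⟨ν, hν.1⟩, rfl⟩
    · rintro _ ⟨μ, rfl⟩
      exact ⟨μ, rfl⟩
  rw [this, finrank_span_eq_card hli, Fintype.card_coe]

/-- The first element at which an independent family differs from the greedy one belongs to the
greedy family. -/
theorem exists_first_difference (he : Function.Injective e)
    (hred : ∀ μ ∉ F₀, v μ ∈ Submodule.span K (v '' {ν | e ν < e μ})) {F : Finset ι}
    (hF : LinearIndependent K (fun μ : F => v μ)) (hne : F ≠ F₀) :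
    ∃ μ, μ ∈ F₀ ∧ μ ∉ F ∧ ∀ ν, e ν < e μ → (ν ∈ F₀ ↔ ν ∈ F) := by
  classical
  obtain ⟨μ, hμ, hmin⟩ := (symmDiff F₀ F).exists_min_image e
    (Finset.symmDiff_nonempty.2 hne.symm)
  have hbelow (ν : ι) (hν : e ν < e μ) : ν ∈ F₀ ↔ ν ∈ F := by
    by_contra h
    refine absurd (hmin ν ?_) (not_le.2 hν)
    rw [Finset.mem_symmDiff]
    tauto
  rcases Finset.mem_symmDiff.1 hμ with ⟨h1, h2⟩ | ⟨h1, h2⟩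
  · exact ⟨μ, h1, h2, hbelow⟩
  · refine absurd ?_ (hF.notMem_span_image (s := {ν : F | e ν < e μ}) (x := ⟨μ, h1⟩) (by simp))
    refine Submodule.span_mono ?_ (mem_span_of_reducible hred μ)
    rintro _ ⟨ν, ⟨hν, hle⟩, rfl⟩
    have hlt : e ν < e μ := hle.lt_of_ne fun h => h2 (he h ▸ hν)
    exact ⟨⟨ν, (hbelow ν hlt).1 hν⟩, hlt, rfl⟩

end Greedy

/-- **Row rank profile equals the pivot-degree family** (Proposition `prop:RRPandrdeg`).
Let `δ` be the s-pivot degrees of the relation module `A_{M,M}` and `r = rank_K(φ_M)`.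
Then `F_δ` is the row rank profile of the ordered matrix of `φ_M`: it is the
lexicographically smallest among all families of `r` monomials whose images under `φ_M`
are K-linearly independent. -/
theorem row_rank_profile_eq_pivot_degrees {K : Type*} [Field K] {m n : ℕ}
    (hmn : n ≤ m) (hn : 0 < n)
    (a : Fin n → Polynomial K) (ha : ∀ i, a i ≠ 0)
    (hdvd : ∀ i j : Fin n, i ≤ j → a j ∣ a i)
    (M : Matrix (Fin m) (Fin n) (Polynomial K)) (s : Fin m → ℤ)
    (P : Fin m → Fin m → Polynomial K) (δ : Fin m → ℕ)
    (hbasis : IsBasisOf P ((Mmod a).comap (Matrix.vecMulLinear (R := Polynomial K) M)))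
    (hpiv : ∀ k, IsPivot s (P k) k (δ k))
    (r : ℕ)
    (hr : r = Module.finrank K (Submodule.span K (Set.range fun μ : ℕ × Fin m =>
      (Submodule.Quotient.mk (pmul M (monov μ)) : (Fin n → Polynomial K) ⧸ Mmod a)))) :
    ((Fd δ).card = r ∧
      LinearIndependent K (fun μ : Fd δ =>
        (Submodule.Quotient.mk (pmul M (monov μ.1)) : (Fin n → Polynomial K) ⧸ Mmod a))) ∧
    ∀ F : Finset (ℕ × Fin m),
      F.card = r →
      LinearIndependent K (fun μ : F =>
        (Submodule.Quotient.mk (pmul M (monov μ.1)) : (Fin n → Polynomial K) ⧸ Mmod a)) →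
      F ≠ Fd δ → famLT s (Fd δ) F := by
  obtain ⟨e, he, hlt⟩ := exists_sTop_key s
  let φ : (Fin m → K[X]) →ₗ[K] ((Fin n → K[X]) ⧸ Mmod a) :=
    ((Mmod a).mkQ.comp (Matrix.vecMulLinear (R := K[X]) M)).restrictScalars K
  have hφ (p : Fin m → K[X]) : φ p = 0 ↔ p ∈ Submodule.span K[X] (Set.range P) := by
    rw [hbasis.2, Submodule.mem_comap]
    exact Submodule.Quotient.mk_eq_zero _
  have hv (μ : ℕ × Fin m) :
      (Submodule.Quotient.mk (pmul M (monov μ)) : (Fin n → K[X]) ⧸ Mmod a) = φ (monov μ) := rfl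
  simp only [hv] at hr ⊢
  have hli := linearIndependent_map_monov hpiv φ fun p => (hφ p).1
  have hred (μ : ℕ × Fin m) (hμ : μ ∉ Fd δ) :=
    map_monov_mem_span hpiv φ (fun p => (hφ p).2) hμ
  simp only [hlt] at hred
  refine ⟨⟨?_, hli⟩, fun F _ hF hne => ?_⟩
  · rw [hr]
    exact card_eq_finrank_of_reducible hli hred
  · obtain ⟨μ, h1, h2, h3⟩ := exists_first_difference he hred hF hne
    exact ⟨μ, h1, h2, fun ν hν => h3 ν ((hlt _ _).1 hν)⟩
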